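/- Let B⊆V be a linearly independent subset with Gr(B) connected, U=span(B) with dim U ≥ 2, and suppose no subset of B is equivalent to a linearly independent set whose graph is E₆. Let v∈V be a vector with Ω(v,u)=1 for some u∈U₀₀₀ (in particular v∉U). Then the coset v+U is the union of exactly two Γ_B-orbits, namely the two nonempty sets (v+U)∩Q_{B∪{v}}⁻¹(0) and (v+U)∩Q_{B∪{v}}⁻¹(1). -/

import Mathlib

open scoped BigOperators

/-- A `ZMod 2`-valued bilinear form on `V`. -/
abbrev BForm (V : Type*) [AddCommGroup V] [Module (ZMod 2) V] :=
  V →ₗ[ZMod 2] V →ₗ[ZMod 2] ZMod 2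

variable {V : Type*} [AddCommGroup V] [Module (ZMod 2) V]

/-- `g` is the transvection `τ_b : x ↦ x + Ω(x,b)·b` for some `b ∈ B`. -/
def IsTransvection (Ω : BForm V) (B : Set V) (g : V ≃ₗ[ZMod 2] V) : Prop :=
  ∃ b ∈ B, ∀ x : V, g x = x + Ω x b • b

/-- The group `Γ_B` generated by the transvections `τ_b`, `b ∈ B`. -/
def Gamma (Ω : BForm V) (B : Set V) : Subgroup (V ≃ₗ[ZMod 2] V) :=
  Subgroup.closure {g | IsTransvection Ω B g}

/-- `x` and `y` lie in the same `Γ_B`-orbit. -/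
def SameOrbit (Ω : BForm V) (B : Set V) (x y : V) : Prop :=
  ∃ g ∈ Gamma Ω B, g x = y

/-- The graph `Gr(X)` on vertex set `X`, with `b, b'` adjacent iff `Ω(b,b') = 1` or `Ω(b',b) = 1`. -/
def Gr (Ω : BForm V) (X : Set V) : SimpleGraph X :=
  SimpleGraph.fromRel fun a b => Ω a.1 b.1 = 1

/-- One basic move: `B' = φ_{c,a}(B)`, replacing `c` by `c + a`. -/
def MoveRel (Ω : BForm V) (B B' : Set V) : Prop :=
  ∃ a c, a ∈ B ∧ c ∈ B ∧ a ≠ c ∧ Ω a c = 1 ∧ B' = insert (c + a) (B \ {c})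

/-- `B` and `B'` are equivalent: related by a finite sequence of basic moves. -/
def EquivSets (Ω : BForm V) : Set V → Set V → Prop :=
  Relation.ReflTransGen (MoveRel Ω)

/-- The kernel `V₀` of the form `Ω`. -/
def V0set (Ω : BForm V) : Set V := {x | ∀ v : V, Ω x v = 0}

/-- `Δ`, the `Γ_B`-orbit containing `B` (when `Gr(B)` is connected). -/
def Delta (Ω : BForm V) (B : Set V) : Set V :=
  {x | ∃ b ∈ B, SameOrbit Ω B b x}

/-- `V₀₀₀`: vectors of `V₀` of the form `x₁ + x₂` with `x₁, x₂ ∈ Δ`. -/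
def V000set (Ω : BForm V) (B : Set V) : Set V :=
  {y | y ∈ V0set Ω ∧ ∃ x₁ ∈ Delta Ω B, ∃ x₂ ∈ Delta Ω B, y = x₁ + x₂}

/-- `U₀₀₀` for `U = span(B)`: vectors of `U₀` of the form `x₁ + x₂` with `x₁, x₂ ∈ Δ`. -/
def U000set (Ω : BForm V) (B : Set V) : Set V :=
  {y | y ∈ Submodule.span (ZMod 2) B ∧ (∀ u ∈ Submodule.span (ZMod 2) B, Ω y u = 0) ∧
    ∃ x₁ ∈ Delta Ω B, ∃ x₂ ∈ Delta Ω B, y = x₁ + x₂}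

/-- `x = x₁ + ⋯ + x_s` with all `x_i ∈ Δ` and `Ω(x_i, x_j) = 0`: a `Δ`-decomposition. -/
def HasDeltaDecomp (Ω : BForm V) (B : Set V) (x : V) (s : ℕ) : Prop :=
  1 ≤ s ∧ ∃ f : Fin s → V, (∀ i, f i ∈ Delta Ω B) ∧
    (∀ i j, i ≠ j → Ω (f i) (f j) = 0) ∧ x = ∑ i, f i

/-- `d(x)`: minimal length of a `Δ`-decomposition of `x`. -/
noncomputable def dval (Ω : BForm V) (B : Set V) (x : V) : ℕ :=
  sInf {s | HasDeltaDecomp Ω B x s}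

/-- `Q` is the quadratic form associated with `Ω` and `S` (`Q(b)=1` on `S`, polarization `Ω`). -/
def IsQuadForm (Ω : BForm V) (S : Set V) (Q : V → ZMod 2) : Prop :=
  (∀ b ∈ S, Q b = 1) ∧ ∀ u v : V, Q (u + v) = Q u + Q v + Ω u v

/-- The tree of type `D_{m,k}`: path `a₁ — ⋯ — a_m` with leaves `c₁, …, c_k` attached to `a_m`. -/
def DmkGraph (m k : ℕ) : SimpleGraph (Fin m ⊕ Fin k) :=
  SimpleGraph.fromRel fun x y =>
    match x, y with
    | Sum.inl i, Sum.inl j => i.val + 1 = j.val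
    | Sum.inl i, Sum.inr _ => i.val + 1 = m
    | _, _ => False

/-- The Dynkin tree `E₆`. -/
def E6Graph : SimpleGraph (Fin 6) :=
  SimpleGraph.fromRel fun i j => (i.val, j.val) ∈ [(0,1),(1,2),(2,3),(3,4),(2,5)]

/-- Two triangles sharing a common edge: four vertices, five edges. -/
def TwoTrianglesGraph : SimpleGraph (Fin 4) :=
  SimpleGraph.fromRel fun i j => (i.val, j.val) ∈ [(0,1),(0,2),(0,3),(1,2),(1,3)]

/-- The cycle of length `n`. -/
def CycleGraph (n : ℕ) : SimpleGraph (Fin n) :=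
  SimpleGraph.fromRel fun i j => j.val = (i.val + 1) % n

/-- Membership in the family `F`: type `D_{2,2}`, two triangles sharing an edge,
or a cycle of length at least `4`. -/
def InF {α : Type*} (G : SimpleGraph α) : Prop :=
  Nonempty (G ≃g DmkGraph 2 2) ∨ Nonempty (G ≃g TwoTrianglesGraph) ∨
    ∃ n, 4 ≤ n ∧ Nonempty (G ≃g CycleGraph n)

/-- `B` is equivalent to a set whose graph is a tree of type `D_{m,k}`. -/
def EquivToDmkTree (Ω : BForm V) (B : Set V) (m k : ℕ) : Prop :=
  ∃ B' : Set V, EquivSets Ω B B' ∧ Nonempty (Gr Ω B' ≃g DmkGraph m k)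

/-- `X` is equivalent to a set whose graph is `E₆`. -/
def EquivToE6 (Ω : BForm V) (X : Set V) : Prop :=
  ∃ X' : Set V, EquivSets Ω X X' ∧ Nonempty (Gr Ω X' ≃g E6Graph)

/-- Some subset of `B` is equivalent to a set whose graph is `E₆`. -/
def HasE6Subgraph (Ω : BForm V) (B : Set V) : Prop :=
  ∃ X ⊆ B, EquivToE6 Ω X

/-- `B` is a basis of `V` (as a set). -/
def IsBasisSet (B : Set V) : Prop :=
  LinearIndependent (ZMod 2) (Subtype.val : B → V) ∧ Submodule.span (ZMod 2) B = ⊤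

/-- `B` is equivalent to a set whose graph is a tree containing `E₆` as an induced subgraph. -/
def EquivToE6Tree (Ω : BForm V) (B : Set V) : Prop :=
  ∃ B' : Set V, EquivSets Ω B B' ∧ (Gr Ω B').IsTree ∧
    ∃ X ⊆ B', Nonempty (Gr Ω X ≃g E6Graph)

/-- `A` is a maximal complete subgraph (maximal clique) of `G`. -/
def IsMaxClique {α : Type*} (G : SimpleGraph α) (A : Set α) : Prop :=
  G.IsClique A ∧ ∀ A', G.IsClique A' → A ⊆ A' → A' = A

section TransvectionOrbits

variable {V : Type*} [AddCommGroup V] [Module (ZMod 2) V] {Ω : BForm V} {B : Set V}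

/-- The transvection `x ↦ x + Ω(x,a)·a` as a linear automorphism. -/
def transvectionEquiv (Ω : BForm V) (hΩ : ∀ x : V, Ω x x = 0) (a : V) : V ≃ₗ[ZMod 2] V :=
  LinearEquiv.ofInvolutive (LinearMap.id + (Ω.flip a).smulRight a) fun x => by
    simp [hΩ, add_assoc, ZModModule.add_self]

theorem transvectionEquiv_apply (hΩ : ∀ x : V, Ω x x = 0) (a x : V) :
    transvectionEquiv Ω hΩ a x = x + Ω x a • a := rfl

theorem alternating_symm (hΩ : ∀ x : V, Ω x x = 0) (x y : V) : Ω x y = Ω y x := by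
  have h := hΩ (x + y)
  simp only [map_add, LinearMap.add_apply, hΩ, zero_add, add_zero] at h
  rwa [CharTwo.add_eq_zero, eq_comm] at h

theorem zmod_two_eq_zero_or_one (a : ZMod 2) : a = 0 ∨ a = 1 := by
  revert a; decide

namespace SameOrbit

protected theorem refl (x : V) : SameOrbit Ω B x x := ⟨1, one_mem _, rfl⟩

protected theorem symm {x y : V} : SameOrbit Ω B x y → SameOrbit Ω B y x := by
  rintro ⟨g, hg, rfl⟩
  exact ⟨g⁻¹, inv_mem hg, g.symm_apply_apply x⟩

protected theorem trans {x y z : V} :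
    SameOrbit Ω B x y → SameOrbit Ω B y z → SameOrbit Ω B x z := by
  rintro ⟨g, hg, rfl⟩ ⟨h, hh, rfl⟩
  exact ⟨h * g, mul_mem hh hg, rfl⟩

end SameOrbit

theorem transvectionEquiv_mem_Gamma (hΩ : ∀ x : V, Ω x x = 0) {b : V} (hb : b ∈ B) :
    transvectionEquiv Ω hΩ b ∈ Gamma Ω B :=
  Subgroup.subset_closure ⟨b, hb, fun _ => rfl⟩

/-- `Γ_B` preserves `Ω`. -/
theorem form_apply_apply_of_mem_Gamma (hΩ : ∀ x : V, Ω x x = 0) {g : V ≃ₗ[ZMod 2] V}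
    (hg : g ∈ Gamma Ω B) (x y : V) : Ω (g x) (g y) = Ω x y := by
  induction hg using Subgroup.closure_induction generalizing x y with
  | mem g hg =>
    obtain ⟨b, -, h⟩ := hg
    simp only [h, map_add, map_smul, LinearMap.add_apply, LinearMap.smul_apply, hΩ,
      smul_eq_mul, mul_zero, add_zero, alternating_symm hΩ b y]
    rw [mul_comm, add_assoc, CharTwo.add_self_eq_zero, add_zero]
  | one => rfl
  | mul g h _ _ ihg ihh => exact (ihg _ _).trans (ihh _ _)
  | inv g _ ih =>
    rw [← ih]
    exact congrArg₂ (fun a b => Ω a b) (g.apply_symm_apply x) (g.apply_symm_apply y)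

/-- `Γ_B` preserves any quadratic form with polarization `Ω` that equals `1` on `B`. -/
theorem quadForm_apply_of_mem_Gamma {Q : V → ZMod 2} (hQ : IsQuadForm Ω B Q)
    {g : V ≃ₗ[ZMod 2] V} (hg : g ∈ Gamma Ω B) (x : V) : Q (g x) = Q x := by
  induction hg using Subgroup.closure_induction generalizing x with
  | mem g hg =>
    obtain ⟨b, hb, h⟩ := hg
    rw [h]
    rcases zmod_two_eq_zero_or_one (Ω x b) with h0 | h1
    · rw [h0, zero_smul, add_zero]
    · rw [h1, one_smul, hQ.2, hQ.1 b hb, h1, add_assoc, CharTwo.add_self_eq_zero, add_zero]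
  | one => rfl
  | mul g h _ _ ihg ihh => exact (ihg _).trans (ihh _)
  | inv g _ ih =>
    rw [← ih]
    exact congrArg Q (g.apply_symm_apply x)

/-- `Γ_B` acts trivially modulo `span B`. -/
theorem apply_add_self_mem_span_of_mem_Gamma {g : V ≃ₗ[ZMod 2] V} (hg : g ∈ Gamma Ω B) (x : V) :
    g x + x ∈ Submodule.span (ZMod 2) B := by
  induction hg using Subgroup.closure_induction generalizing x with
  | mem g hg =>
    obtain ⟨b, hb, h⟩ := hg
    rw [h, add_right_comm, ZModModule.add_self, zero_add]
    exact Submodule.smul_mem _ _ (Submodule.subset_span hb)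
  | one =>
    change x + x ∈ _
    rw [ZModModule.add_self]
    exact zero_mem _
  | mul g h _ _ ihg ihh =>
    have := add_mem (ihg (h x)) (ihh x)
    rwa [add_assoc, ← add_assoc (h x), ZModModule.add_self, zero_add] at this
  | inv g _ ih =>
    have := ih (g⁻¹ x)
    rw [add_comm]
    rwa [show g (g⁻¹ x) = x from g.apply_symm_apply x] at this

/-- `Γ_B` fixes every vector orthogonal to `B`. -/
theorem apply_eq_self_of_mem_Gamma {u : V} (hu : ∀ b ∈ B, Ω u b = 0)
    {g : V ≃ₗ[ZMod 2] V} (hg : g ∈ Gamma Ω B) : g u = u := by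
  induction hg using Subgroup.closure_induction with
  | mem g hg =>
    obtain ⟨b, hb, h⟩ := hg
    rw [h, hu b hb, zero_smul, add_zero]
  | one => rfl
  | mul g h _ _ ihg ihh => exact (congrArg g ihh).trans ihg
  | inv g _ ih => exact (LinearEquiv.symm_apply_eq g).2 ih.symm

/-- When `Gr(B)` is connected, all elements of `B` lie in one `Γ_B`-orbit. -/
theorem sameOrbit_of_connected (hΩ : ∀ x : V, Ω x x = 0) (hconn : (Gr Ω B).Connected)
    {a b : V} (ha : a ∈ B) (hb : b ∈ B) : SameOrbit Ω B a b := by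
  have adj : ∀ c d : B, (Gr Ω B).Adj c d → SameOrbit Ω B c.1 d.1 := by
    intro c d h
    have h1 : Ω c.1 d.1 = 1 := by
      rcases ((SimpleGraph.fromRel_adj _ _ _).1 h).2 with h | h
      · exact h
      · rw [alternating_symm hΩ]; exact h
    refine ⟨transvectionEquiv Ω hΩ c.1 * transvectionEquiv Ω hΩ d.1,
      mul_mem (transvectionEquiv_mem_Gamma hΩ c.2) (transvectionEquiv_mem_Gamma hΩ d.2), ?_⟩
    change transvectionEquiv Ω hΩ c.1 (transvectionEquiv Ω hΩ d.1 c.1) = d.1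
    rw [transvectionEquiv_apply, transvectionEquiv_apply, h1, one_smul, map_add,
      LinearMap.add_apply, hΩ, alternating_symm hΩ d.1 c.1, h1, zero_add, one_smul,
      add_right_comm, ZModModule.add_self, zero_add]
  obtain ⟨w⟩ := hconn.preconnected ⟨a, ha⟩ ⟨b, hb⟩
  suffices ∀ c d : B, (Gr Ω B).Walk c d → SameOrbit Ω B c.1 d.1 from this _ _ w
  intro c d p
  induction p with
  | nil => exact SameOrbit.refl _
  | cons h _ ih => exact (adj _ _ h).trans ih

/-- When `Gr(B)` is connected, `Δ` is a single `Γ_B`-orbit. -/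
theorem sameOrbit_of_mem_Delta (hΩ : ∀ x : V, Ω x x = 0) (hconn : (Gr Ω B).Connected)
    {x y : V} (hx : x ∈ Delta Ω B) (hy : y ∈ Delta Ω B) : SameOrbit Ω B x y := by
  obtain ⟨a, ha, hax⟩ := hx
  obtain ⟨b, hb, hby⟩ := hy
  exact hax.symm.trans ((sameOrbit_of_connected hΩ hconn ha hb).trans hby)

/-- Transvections in elements of `Δ` belong to `Γ_B`, so `z` and `z + d` share an orbit
when `d ∈ Δ` and `Ω(z,d) = 1`. -/
theorem sameOrbit_add_of_mem_Delta (hΩ : ∀ x : V, Ω x x = 0) {d z : V} (hd : d ∈ Delta Ω B)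
    (hz : Ω z d = 1) : SameOrbit Ω B z (z + d) := by
  obtain ⟨b, hb, g, hg, rfl⟩ := hd
  refine ⟨g * transvectionEquiv Ω hΩ b * g⁻¹,
    mul_mem (mul_mem hg (transvectionEquiv_mem_Gamma hΩ hb)) (inv_mem hg), ?_⟩
  change g (transvectionEquiv Ω hΩ b (g⁻¹ z)) = z + g b
  have hgz : g (g⁻¹ z) = z := g.apply_symm_apply z
  have h1 : Ω (g⁻¹ z) b = 1 := by
    rw [← form_apply_apply_of_mem_Gamma hΩ hg, hgz, hz]
  rw [transvectionEquiv_apply, h1, one_smul, map_add, hgz]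

/-- `Δ` is stable under translation by elements of `U₀₀₀`. -/
theorem add_mem_Delta_of_mem_U000set (hΩ : ∀ x : V, Ω x x = 0) (hconn : (Gr Ω B).Connected)
    {u d : V} (hu : u ∈ U000set Ω B) (hd : d ∈ Delta Ω B) : d + u ∈ Delta Ω B := by
  obtain ⟨-, hu0, x₁, hx₁, x₂, hx₂, hux⟩ := hu
  obtain ⟨g, hg, rfl⟩ := sameOrbit_of_mem_Delta hΩ hconn hx₁ hd
  have hgu : g u = u :=
    apply_eq_self_of_mem_Gamma (fun b hb => hu0 b (Submodule.subset_span hb)) hg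
  have hx : g x₁ + u = g x₂ := by
    rw [← hgu, ← map_add, hux, ← add_assoc, ZModModule.add_self, zero_add]
  obtain ⟨b, hb, hbx⟩ := hx₂
  exact ⟨b, hb, hx ▸ hbx.trans ⟨g, hg, rfl⟩⟩

/-- If `Ω(z,u) = 1` with `u ∈ U₀₀₀`, the orbit of `z` meets every class of `z + U` modulo `u`. -/
theorem sameOrbit_add_or_add_add (hΩ : ∀ x : V, Ω x x = 0) (hconn : (Gr Ω B).Connected)
    {u z w : V} (hu : u ∈ U000set Ω B) (hzu : Ω z u = 1)
    (hw : w ∈ Submodule.span (ZMod 2) B) :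
    SameOrbit Ω B z (z + w) ∨ SameOrbit Ω B z (z + w + u) := by
  have hu0 : ∀ x ∈ Submodule.span (ZMod 2) B, Ω x u = 0 := fun x hx => by
    rw [alternating_symm hΩ]; exact hu.2.1 x hx
  have step : ∀ b ∈ B, ∀ y, Ω y u = 1 →
      SameOrbit Ω B y (y + b) ∨ SameOrbit Ω B y (y + b + u) := by
    intro b hb y hy
    have hbΔ : b ∈ Delta Ω B := ⟨b, hb, SameOrbit.refl b⟩
    rcases zmod_two_eq_zero_or_one (Ω y b) with h | h
    · right
      rw [add_assoc]
      refine sameOrbit_add_of_mem_Delta hΩ (add_mem_Delta_of_mem_U000set hΩ hconn hu hbΔ) ?_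
      rw [map_add, h, hy, zero_add]
    · exact Or.inl (sameOrbit_add_of_mem_Delta hΩ hbΔ h)
  have cancel : ∀ a b : V, a + u + b + u = a + b := fun a b => by
    rw [add_right_comm a u b, add_assoc, ZModModule.add_self, add_zero]
  induction hw using Submodule.span_induction generalizing z with
  | mem b hb => exact step b hb z hzu
  | zero => exact Or.inl (by rw [add_zero]; exact SameOrbit.refl z)
  | add x y hx hy ihx ihy =>
    have hzx : Ω (z + x) u = 1 := by simp [hzu, hu0 x hx]
    have hzxu : Ω (z + x + u) u = 1 := by simp [hzu, hu0 x hx, hΩ]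
    rw [← add_assoc]
    rcases ihx hzu with h | h
    · exact (ihy hzx).imp h.trans h.trans
    · rcases ihy hzxu with h' | h'
      · exact Or.inr (by rw [add_right_comm]; exact h.trans h')
      · exact Or.inl (by rw [← cancel]; exact h.trans h')
  | smul a x hx ih =>
    rcases zmod_two_eq_zero_or_one a with rfl | rfl
    · exact Or.inl (by rw [zero_smul, add_zero]; exact SameOrbit.refl z)
    · rw [one_smul]; exact ih hzu

/-- A quadratic form equal to `1` on `B` vanishes on `U₀₀₀`. -/
theorem quadForm_eq_zero_of_mem_U000set (hΩ : ∀ x : V, Ω x x = 0) {Q : V → ZMod 2}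
    (hQ : IsQuadForm Ω B Q) {u : V} (hu : u ∈ U000set Ω B) : Q u = 0 := by
  obtain ⟨-, hu0, x₁, ⟨b₁, hb₁, g₁, hg₁, rfl⟩, x₂, ⟨b₂, hb₂, g₂, hg₂, rfl⟩, rfl⟩ := hu
  have hmem : g₁ b₁ ∈ Submodule.span (ZMod 2) B := by
    have := add_mem (apply_add_self_mem_span_of_mem_Gamma hg₁ b₁) (Submodule.subset_span hb₁)
    rwa [add_assoc, ZModModule.add_self, add_zero] at this
  have h := hu0 _ hmem
  rw [map_add, LinearMap.add_apply, hΩ, zero_add, alternating_symm hΩ] at h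
  rw [hQ.2, quadForm_apply_of_mem_Gamma hQ hg₁, quadForm_apply_of_mem_Gamma hQ hg₂,
    hQ.1 b₁ hb₁, hQ.1 b₂ hb₂, h, add_zero, CharTwo.add_self_eq_zero]

end TransvectionOrbits

/-- Let `B` be linearly independent with `Gr(B)` connected,
`U = span(B)` with `dim U ≥ 2`, no subset of `B` equivalent to an `E₆`-set, and let
`v` satisfy `Ω(v,u) = 1` for some `u ∈ U₀₀₀`. Then `v + U` consists of exactly two
`Γ_B`-orbits: the nonempty sets `(v+U) ∩ Q_{B∪{v}}⁻¹(0)` and `(v+U) ∩ Q_{B∪{v}}⁻¹(1)`. -/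
theorem stmt_11 {V : Type*} [AddCommGroup V] [Module (ZMod 2) V]
    [FiniteDimensional (ZMod 2) V]
    (Ω : BForm V) (hΩ : ∀ x : V, Ω x x = 0)
    (B : Set V) (hli : LinearIndependent (ZMod 2) (Subtype.val : B → V))
    (hconn : (Gr Ω B).Connected)
    (hdim : 2 ≤ Module.finrank (ZMod 2) (Submodule.span (ZMod 2) B))
    (hnoE6 : ¬ HasE6Subgraph Ω B)
    (v : V) (u : V) (hu : u ∈ U000set Ω B) (hvu : Ω v u = 1)
    (Q : V → ZMod 2) (hQ : IsQuadForm Ω (insert v B) Q) :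
    (∃ z : V, z + v ∈ Submodule.span (ZMod 2) B ∧ Q z = 0) ∧
    (∃ z : V, z + v ∈ Submodule.span (ZMod 2) B ∧ Q z = 1) ∧
    (∀ z : V, z + v ∈ Submodule.span (ZMod 2) B → ∀ y : V,
      (SameOrbit Ω B z y ↔ (y + v ∈ Submodule.span (ZMod 2) B ∧ Q y = Q z))) := by
  have hQB : IsQuadForm Ω B Q := ⟨fun b hb => hQ.1 b (Set.mem_insert_of_mem v hb), hQ.2⟩
  have hQu : Q u = 0 := quadForm_eq_zero_of_mem_U000set hΩ hQB hu
  have hQv : Q v = 1 := hQ.1 v (Set.mem_insert v B)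
  refine ⟨⟨v + u, ?_, ?_⟩, ⟨v, ?_, hQv⟩, fun z hz y => ⟨?_, ?_⟩⟩
  · rw [add_right_comm, ZModModule.add_self, zero_add]
    exact hu.1
  · rw [hQ.2, hQu, hQv, hvu, add_zero, CharTwo.add_self_eq_zero]
  · rw [ZModModule.add_self]
    exact zero_mem _
  · rintro ⟨g, hg, rfl⟩
    refine ⟨?_, quadForm_apply_of_mem_Gamma hQB hg z⟩
    have := add_mem (apply_add_self_mem_span_of_mem_Gamma hg z) hz
    rwa [add_assoc, ← add_assoc z, ZModModule.add_self, zero_add] at this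
  · rintro ⟨hy, hQy⟩
    have hzy : z + y ∈ Submodule.span (ZMod 2) B := by
      have := add_mem hz hy
      rwa [add_add_add_comm, ZModModule.add_self, add_zero] at this
    have unit : ∀ x, x + v ∈ Submodule.span (ZMod 2) B → Ω x u = 1 := fun x hx => by
      have h := hu.2.1 _ hx
      rwa [alternating_symm hΩ, map_add, LinearMap.add_apply, hvu, CharTwo.add_eq_zero] at h
    have h := sameOrbit_add_or_add_add hΩ hconn hu (unit z hz) hzy
    rw [← add_assoc, ZModModule.add_self, zero_add] at h
    refine h.resolve_right ?_
    rintro ⟨g, hg, hgz⟩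
    have hQz := quadForm_apply_of_mem_Gamma hQB hg z
    rw [hgz, hQ.2, hQu, unit y hy, hQy, add_zero] at hQz
    exact one_ne_zero (left_eq_add.1 hQz.symm)
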